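/- arXiv:2103.14305 — 5 statements merged into one kernel-verified Lean document; each statement's English description precedes it below -/
import Mathlib

section
/- Let Ã₀,Ã₁,…,Ã_{d−1} be fixed N×N complex matrices, and for (τ,η,ξ) ∈ ℝ×ℝ^{d−1}×ℝ set L̃(τ,η,ξ) := τ·Ã₀ + Σ_{i=1}^{d−1} ηᵢ·Ãᵢ + ξ·I. Let Ω ⊆ ℝ^{d−1}×ℝ be open, τ : Ω → ℝ and π : Ω → M_N(ℂ) differentiable, and π̃ : Ω → M_N(ℂ) any function, such that for all (η,ξ) ∈ Ω: L̃(τ(η,ξ),η,ξ)·π(η,ξ) = 0 and π̃(η,ξ)·L̃(τ(η,ξ),η,ξ) = 0. Then at every point (η,ξ) ∈ Ω where ∂_ξτ(η,ξ) ≠ 0, one has π̃(η,ξ)·Ã₀·π(η,ξ) = −(1/∂_ξτ(η,ξ))·π̃(η,ξ)·π(η,ξ), and for each i = 1,…,d−1: π̃(η,ξ)·Ãᵢ·π(η,ξ) = (∂_{ηᵢ}τ(η,ξ)/∂_ξτ(η,ξ))·π̃(η,ξ)·π(η,ξ). -/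
attribute [local instance] Matrix.normedAddCommGroup Matrix.normedSpace

theorem HasDerivAt.matrix_mul {l m n : Type*} [Fintype l] [Fintype m] [Fintype n]
    {F : ℝ → Matrix l m ℂ} {G : ℝ → Matrix m n ℂ} {F' : Matrix l m ℂ} {G' : Matrix m n ℂ} {t : ℝ}
    (hF : HasDerivAt F F' t) (hG : HasDerivAt G G' t) :
    HasDerivAt (fun s => F s * G s) (F' * G t + F t * G') t := by
  have hFe : ∀ i j, HasDerivAt (fun s => F s i j) (F' i j) t := fun i j =>
    hasDerivAt_pi.1 (hasDerivAt_pi.1 hF i) j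
  have hGe : ∀ i j, HasDerivAt (fun s => G s i j) (G' i j) t := fun i j =>
    hasDerivAt_pi.1 (hasDerivAt_pi.1 hG i) j
  refine hasDerivAt_pi.2 fun i => hasDerivAt_pi.2 fun j => ?_
  simpa only [Matrix.mul_apply, Matrix.add_apply, Finset.sum_add_distrib, Pi.mul_apply] using
    HasDerivAt.fun_sum fun k (_ : k ∈ Finset.univ) => (hFe i k).mul (hGe k j)

/-- Differentiating `L * P = 0` and multiplying on the left by an annihilator `Q` of `L`. -/
theorem mul_deriv_mul_eq_zero {n : Type*} [Fintype n]
    {F G : ℝ → Matrix n n ℂ} {F' G' Q : Matrix n n ℂ} {t : ℝ}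
    (hF : HasDerivAt F F' t) (hG : HasDerivAt G G' t)
    (hFG : (fun s => F s * G s) =ᶠ[nhds t] 0) (hQ : Q * F t = 0) :
    Q * F' * G t = 0 := by
  have h : F' * G t + F t * G' = 0 :=
    (hF.matrix_mul hG).unique
      ((hasDerivAt_const t (0 : Matrix n n ℂ)).congr_of_eventuallyEq hFG)
  calc Q * F' * G t = Q * (F' * G t + F t * G') := by
        rw [mul_add, ← mul_assoc, ← mul_assoc, hQ, zero_mul, add_zero]
    _ = 0 := by rw [h, mul_zero]

/-- Modified Lax lemma: with `L̃(t,η,ξ) = t·Ã₀ + Σ ηᵢ·Ãᵢ + ξ·I`, if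
`L̃(τ(η,ξ),η,ξ)·π(η,ξ) = 0` and `π̃(η,ξ)·L̃(τ(η,ξ),η,ξ) = 0` on an open set, then at any
point where `∂_ξ τ ≠ 0` one has `π̃·Ã₀·π = −(1/∂_ξτ)·π̃·π` and
`π̃·Ãᵢ·π = (∂_{ηᵢ}τ/∂_ξτ)·π̃·π`. -/
theorem stmt_3 {N m : ℕ}
    (A₀ : Matrix (Fin N) (Fin N) ℂ) (A : Fin m → Matrix (Fin N) (Fin N) ℂ)
    (Ω : Set ((Fin m → ℝ) × ℝ)) (hΩ : IsOpen Ω)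
    (τ : (Fin m → ℝ) × ℝ → ℝ)
    (π πt : (Fin m → ℝ) × ℝ → Matrix (Fin N) (Fin N) ℂ)
    (hτ : DifferentiableOn ℝ τ Ω) (hπ : DifferentiableOn ℝ π Ω)
    (hL : ∀ p ∈ Ω,
      (τ p • A₀ + ∑ i, p.1 i • A i + p.2 • (1 : Matrix (Fin N) (Fin N) ℂ)) * π p = 0)
    (hLt : ∀ p ∈ Ω,
      πt p * (τ p • A₀ + ∑ i, p.1 i • A i + p.2 • (1 : Matrix (Fin N) (Fin N) ℂ)) = 0) :
    ∀ p ∈ Ω, fderiv ℝ τ p ((0 : Fin m → ℝ), (1 : ℝ)) ≠ 0 →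
      (πt p * A₀ * π p =
        (-((fderiv ℝ τ p ((0 : Fin m → ℝ), (1 : ℝ)))⁻¹)) • (πt p * π p)) ∧
      (∀ i : Fin m, πt p * A i * π p =
        (fderiv ℝ τ p (Pi.single i 1, (0 : ℝ)) /
          fderiv ℝ τ p ((0 : Fin m → ℝ), (1 : ℝ))) • (πt p * π p)) := by
  intro p hp hξ
  have key : ∀ v : (Fin m → ℝ) × ℝ,
      πt p * (fderiv ℝ τ p v • A₀ + ∑ i, v.1 i • A i + v.2 • (1 : Matrix (Fin N) (Fin N) ℂ))
        * π p = 0 := by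
    intro v
    have hmem : Ω ∈ nhds p := hΩ.mem_nhds hp
    have hline : HasDerivAt (fun t : ℝ => p + t • v) v 0 := by
      simpa using ((hasDerivAt_id (0 : ℝ)).smul_const v).const_add p
    have hp0 : p + (0 : ℝ) • v = p := by simp
    have hτv : HasDerivAt (fun t : ℝ => τ (p + t • v)) (fderiv ℝ τ p v) 0 :=
      HasFDerivAt.comp_hasDerivAt_of_eq 0 (hτ.differentiableAt hmem).hasFDerivAt hline hp0.symm
    have hπv : HasDerivAt (fun t : ℝ => π (p + t • v)) (fderiv ℝ π p v) 0 :=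
      HasFDerivAt.comp_hasDerivAt_of_eq 0 (hπ.differentiableAt hmem).hasFDerivAt hline hp0.symm
    have hη : ∀ i, HasDerivAt (fun t : ℝ => (p + t • v).1 i) (v.1 i) 0 := fun i => by
      simpa using ((hasDerivAt_id (0 : ℝ)).mul_const (v.1 i)).const_add (p.1 i)
    have hζ : HasDerivAt (fun t : ℝ => (p + t • v).2) v.2 0 := by
      simpa using ((hasDerivAt_id (0 : ℝ)).mul_const v.2).const_add p.2
    have hLv := ((hτv.smul_const A₀).add
      (HasDerivAt.fun_sum fun i (_ : i ∈ Finset.univ) => (hη i).smul_const (A i))).add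
      (hζ.smul_const (1 : Matrix (Fin N) (Fin N) ℂ))
    have hev : ∀ᶠ t in nhds (0 : ℝ), p + t • v ∈ Ω :=
      hline.continuousAt.eventually_mem (by simpa only [hp0] using hmem)
    have h := mul_deriv_mul_eq_zero (Q := πt p) hLv hπv
      (hev.mono fun t ht => hL _ ht) (by simpa using hLt p hp)
    simpa only [hp0] using h
  have hA₀ : fderiv ℝ τ p (0, 1) • (πt p * A₀ * π p) + πt p * π p = 0 := by
    simpa [mul_add, add_mul] using key (0, 1)
  have h₀ : πt p * A₀ * π p = (-(fderiv ℝ τ p (0, 1))⁻¹) • (πt p * π p) := by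
    rw [eq_neg_of_add_eq_zero_right hA₀, smul_neg, neg_smul, neg_neg, inv_smul_smul₀ hξ]
  refine ⟨h₀, fun i => ?_⟩
  have hA : fderiv ℝ τ p (Pi.single i 1, 0) • (πt p * A₀ * π p) + πt p * A i * π p = 0 := by
    simpa [mul_add, add_mul, Pi.single_apply, ite_smul] using key (Pi.single i 1, 0)
  rw [eq_neg_of_add_eq_zero_right hA, h₀, smul_smul, ← neg_smul, mul_neg, neg_neg, div_eq_mul_inv]
end

section
/- Let A₁,…,A_d be fixed N×N complex matrices with A_d invertible, and for (τ,η,ξ) ∈ ℝ×ℝ^{d−1}×ℝ set L(τ,η,ξ) := τ·I + Σ_{i=1}^{d−1} ηᵢ·Aᵢ + ξ·A_d. Let Ω ⊆ ℝ^{d−1}×ℝ be open, τ : Ω → ℝ and π : Ω → M_N(ℂ) differentiable with L(τ(η,ξ),η,ξ)·π(η,ξ) = 0 for all (η,ξ) ∈ Ω. Suppose that at a point (η̲,ξ̲) ∈ Ω one has ∂_ξτ(η̲,ξ̲) = 0, and set 𝒜 := −i·A_d⁻¹·(τ(η̲,ξ̲)·I + Σ_{i=1}^{d−1} η̲ᵢ·Aᵢ).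 Then (𝒜 − i·ξ̲·I)·(∂_ξπ(η̲,ξ̲)) = i·π(η̲,ξ̲). -/
attribute [local instance] Matrix.normedAddCommGroup Matrix.normedSpace

/-- Product rule for matrix-valued functions of a real variable, for the entrywise norm. -/
theorem Matrix.hasDerivAt_mul {l m n : Type*} [Fintype l] [Fintype m] [Fintype n]
    {M : ℝ → Matrix l m ℂ} {P : ℝ → Matrix m n ℂ} {M' : Matrix l m ℂ} {P' : Matrix m n ℂ} {t : ℝ}
    (hM : HasDerivAt M M' t) (hP : HasDerivAt P P' t) :
    HasDerivAt (fun s => M s * P s) (M' * P t + M t * P') t := by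
  have hM' (i : l) (j : m) : HasDerivAt (fun s => M s i j) (M' i j) t :=
    hasDerivAt_pi.1 (hasDerivAt_pi.1 hM i) j
  have hP' (i : m) (j : n) : HasDerivAt (fun s => P s i j) (P' i j) t :=
    hasDerivAt_pi.1 (hasDerivAt_pi.1 hP i) j
  refine hasDerivAt_pi.2 fun i => hasDerivAt_pi.2 fun j => ?_
  simp only [Matrix.mul_apply, Matrix.add_apply, ← Finset.sum_add_distrib]
  exact HasDerivAt.fun_sum fun k _ => (hM' i k).mul (hP' k j)

/-- Generalized eigenvector identity at a glancing point: if
`L(τ,η,ξ) = τI + Σ ηᵢAᵢ + ξA_d` with `A_d` invertible, `L(τ(η,ξ),η,ξ)·π(η,ξ) = 0` on an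
open set, and at a point `p₀ = (η̲,ξ̲)` the normal group velocity `∂_ξτ` vanishes, then
with `𝒜 := −i·A_d⁻¹·(τ(p₀)·I + Σ η̲ᵢAᵢ)` one has `(𝒜 − i·ξ̲·I)·(∂_ξπ(p₀)) = i·π(p₀)`. -/
theorem stmt_6 {N m : ℕ}
    (A : Fin m → Matrix (Fin N) (Fin N) ℂ) (Ad : Matrix (Fin N) (Fin N) ℂ)
    (hAd : IsUnit Ad)
    (Ω : Set ((Fin m → ℝ) × ℝ)) (hΩ : IsOpen Ω)
    (τ : (Fin m → ℝ) × ℝ → ℝ)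
    (π : (Fin m → ℝ) × ℝ → Matrix (Fin N) (Fin N) ℂ)
    (hτ : DifferentiableOn ℝ τ Ω) (hπ : DifferentiableOn ℝ π Ω)
    (hL : ∀ p ∈ Ω,
      (τ p • (1 : Matrix (Fin N) (Fin N) ℂ) + ∑ i, p.1 i • A i + p.2 • Ad) * π p = 0)
    (p₀ : (Fin m → ℝ) × ℝ) (hp₀ : p₀ ∈ Ω)
    (hglancing : fderiv ℝ τ p₀ ((0 : Fin m → ℝ), (1 : ℝ)) = 0) :
    ((-Complex.I) • (Ad⁻¹ *
        (τ p₀ • (1 : Matrix (Fin N) (Fin N) ℂ) + ∑ i, p₀.1 i • A i)) -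
      (Complex.I * (p₀.2 : ℂ)) • (1 : Matrix (Fin N) (Fin N) ℂ)) *
        fderiv ℝ π p₀ ((0 : Fin m → ℝ), (1 : ℝ))
      = Complex.I • π p₀ := by
  obtain ⟨η, ξ⟩ := p₀
  have hline : HasDerivAt (fun t : ℝ => (η, t)) ((0 : Fin m → ℝ), (1 : ℝ)) ξ :=
    (hasDerivAt_const ξ η).prodMk (hasDerivAt_id ξ)
  have hΩ' : Ω ∈ nhds (η, ξ) := hΩ.mem_nhds hp₀
  have hτ' : HasDerivAt (fun t => τ (η, t)) 0 ξ := by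
    rw [← hglancing]
    exact (hτ.differentiableAt hΩ').hasFDerivAt.comp_hasDerivAt ξ hline
  have hπ' : HasDerivAt (fun t => π (η, t)) (fderiv ℝ π (η, ξ) (0, 1)) ξ :=
    (hπ.differentiableAt hΩ').hasFDerivAt.comp_hasDerivAt ξ hline
  generalize fderiv ℝ π (η, ξ) (0, 1) = P at hπ' ⊢
  have hsymbol : HasDerivAt
      (fun t => τ (η, t) • (1 : Matrix (Fin N) (Fin N) ℂ) + ∑ i, η i • A i + t • Ad) Ad ξ := by
    have h := ((hτ'.smul_const (1 : Matrix (Fin N) (Fin N) ℂ)).add_const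
      (∑ i, η i • A i)).add ((hasDerivAt_id ξ).smul_const Ad)
    rw [zero_smul, zero_add, one_smul] at h
    exact h
  have hzero : (fun t => (τ (η, t) • (1 : Matrix (Fin N) (Fin N) ℂ) + ∑ i, η i • A i
      + t • Ad) * π (η, t)) =ᶠ[nhds ξ] fun _ => 0 := by
    filter_upwards [hline.continuousAt.preimage_mem_nhds hΩ'] with t ht using hL _ ht
  have hprod := (Matrix.hasDerivAt_mul hsymbol hπ').unique
    ((hasDerivAt_const ξ 0).congr_of_eventuallyEq hzero)
  have hinv : Ad⁻¹ * Ad = 1 :=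
    Matrix.nonsing_inv_mul Ad ((Matrix.isUnit_iff_isUnit_det Ad).1 hAd)
  dsimp only at hprod ⊢
  generalize τ (η, ξ) • (1 : Matrix (Fin N) (Fin N) ℂ) + ∑ i, η i • A i = T at hprod ⊢
  have hξ : (Complex.I * (ξ : ℂ)) • (1 : Matrix (Fin N) (Fin N) ℂ)
      = Complex.I • (Ad⁻¹ * (ξ • Ad)) := by
    rw [Matrix.mul_smul, hinv, mul_smul, Complex.coe_smul]
  calc ((-Complex.I) • (Ad⁻¹ * T) - (Complex.I * (ξ : ℂ)) • (1 : Matrix (Fin N) (Fin N) ℂ)) * P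
      = (-Complex.I) • (Ad⁻¹ * ((T + ξ • Ad) * P)) := by
        rw [hξ, ← Matrix.mul_assoc, Matrix.mul_add, ← Matrix.smul_mul (-Complex.I) (_ + _) P,
          smul_add, neg_smul Complex.I (Ad⁻¹ * (ξ • Ad)), ← sub_eq_add_neg]
    _ = Complex.I • π (η, ξ) := by
        rw [eq_neg_of_add_eq_zero_right hprod, Matrix.mul_neg, ← Matrix.mul_assoc, hinv,
          Matrix.one_mul, smul_neg, neg_smul, neg_neg]
end

section
/- Let c₀ > 0, η₀ > 0, u₀ ≠ 0 and δ > 1 be real numbers. For (a,b) ∈ ℤ² \ {(0,0)} set τ_{a,b} := c₀η₀(a + δb), η_{a,b} := η₀(a + b), and N_{a,b} := √(η_{a,b}² + τ_{a,b}²/u₀²) (which is strictly positive), and for pairs with (a,b), (c,d), (a+c, b+d) all nonzero define Γ((a,b),(c,d)) := −(τ_{a,b}·η_{c,d} − τ_{c,d}·η_{a,b})·(τ_{a+c,b+d}·τ_{c,d} + u₀²·η_{a+c,b+d}·η_{c,d}) / (u₀⁴·N_{a,b}·N_{c,d}·N_{a+c,b+d}). Then for all (p,q), (r,s) ∈ ℤ²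 with (p,q), (r,s) and (p+r, q+s) nonzero, setting (t,w) := (−p−r, −q−s), one has Γ((p,q),(r,s)) + Γ((p,q),(t,w)) = 0. -/
/-- Cancellation of resonance coefficients for the linear family of the 2D Euler
system: with `τ_{a,b} = c₀η₀(a+δb)`, `η_{a,b} = η₀(a+b)`,
`N_{a,b} = √(η_{a,b}² + τ_{a,b}²/u₀²)` (positive for nonzero `(a,b)`), and the
resonance coefficient `Γ` given by the explicit formula, one has
`Γ((p,q),(r,s)) + Γ((p,q),(t,w)) = 0` whenever `(p,q)+(r,s)+(t,w) = 0` and all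
relevant indices are nonzero. -/
theorem stmt_17 (c₀ η₀ u₀ δ : ℝ) (hc₀ : 0 < c₀) (hη₀ : 0 < η₀) (hu₀ : u₀ ≠ 0)
    (hδ : 1 < δ)
    (τ η Nf : ℤ × ℤ → ℝ) (Γ : ℤ × ℤ → ℤ × ℤ → ℝ)
    (hτ : ∀ a b : ℤ, τ (a, b) = c₀ * η₀ * ((a : ℝ) + δ * (b : ℝ)))
    (hη : ∀ a b : ℤ, η (a, b) = η₀ * ((a : ℝ) + (b : ℝ)))
    (hN : ∀ a b : ℤ, Nf (a, b) = Real.sqrt ((η (a, b))^2 + (τ (a, b))^2 / u₀^2))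
    (hΓ : ∀ x y : ℤ × ℤ, x ≠ 0 → y ≠ 0 → x + y ≠ 0 →
      Γ x y = -((τ x * η y - τ y * η x) *
          (τ (x + y) * τ y + u₀^2 * η (x + y) * η y)) /
        (u₀^4 * Nf x * Nf y * Nf (x + y))) :
    (∀ a b : ℤ, ¬(a = 0 ∧ b = 0) → 0 < Nf (a, b)) ∧
    (∀ p q r s : ℤ, ((p, q) : ℤ × ℤ) ≠ 0 → ((r, s) : ℤ × ℤ) ≠ 0 →
      ((p + r, q + s) : ℤ × ℤ) ≠ 0 →
      Γ (p, q) (r, s) + Γ (p, q) (-p - r, -q - s) = 0) := by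
  refine ⟨fun a b hab => ?_, fun p q r s hx hy hxy => ?_⟩
  · rw [hN, Real.sqrt_pos]
    by_cases h : η (a, b) = 0
    · have hτ_ne : τ (a, b) ≠ 0 := by
        intro h'
        rw [hη] at h
        rw [hτ] at h'
        have h1 : (a : ℝ) + b = 0 := (mul_eq_zero.mp h).resolve_left hη₀.ne'
        have h2 : (a : ℝ) + δ * b = 0 :=
          (mul_eq_zero.mp h').resolve_left (mul_pos hc₀ hη₀).ne'
        have h3 : (δ - 1) * (b : ℝ) = 0 := by linear_combination h2 - h1
        have hb : (b : ℝ) = 0 := (mul_eq_zero.mp h3).resolve_left (by linarith)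
        have ha : (a : ℝ) = 0 := by linarith
        exact hab ⟨by exact_mod_cast ha, by exact_mod_cast hb⟩
      positivity
    · positivity
  · have hτ_neg : ∀ a b : ℤ, τ (-a, -b) = -τ (a, b) := by
      intro a b
      simp only [hτ]
      push_cast
      ring
    have hη_neg : ∀ a b : ℤ, η (-a, -b) = -η (a, b) := by
      intro a b
      simp only [hη]
      push_cast
      ring
    have hN_neg : ∀ a b : ℤ, Nf (-a, -b) = Nf (a, b) := by
      intro a b
      rw [hN, hN, hτ_neg, hη_neg, neg_sq, neg_sq]
    have hτ_add : τ (p + r, q + s) = τ (p, q) + τ (r, s) := by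
      simp only [hτ]
      push_cast
      ring
    have hη_add : η (p + r, q + s) = η (p, q) + η (r, s) := by
      simp only [hη]
      push_cast
      ring
    have ht : ((-p - r, -q - s) : ℤ × ℤ) = (-(p + r), -(q + s)) := by
      ext <;> ring
    have hsum : ((p, q) : ℤ × ℤ) + (-(p + r), -(q + s)) = (-r, -s) := by
      ext <;> simp
    have ht_ne : ((-(p + r), -(q + s)) : ℤ × ℤ) ≠ 0 := neg_ne_zero.mpr hxy
    have hy_ne : ((-r, -s) : ℤ × ℤ) ≠ 0 := neg_ne_zero.mpr hy
    rw [ht, hΓ _ _ hx hy hxy, hΓ _ _ hx ht_ne (hsum ▸ hy_ne), hsum, Prod.mk_add_mk]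
    simp only [hτ_neg, hη_neg, hN_neg, hτ_add, hη_add]
    ring
end

section
/- Let v₀ > 0 and 0 < u₀ < c₀. For (η,ξ) ∈ ℝ² \ {(0,0)} define E₂(η,ξ) := (0, ξ, −η)/√(η²+ξ²) ∈ ℝ³, the matrix A₂ := [[u₀, 0, −v₀], [0, u₀, 0], [−c₀²/v₀, 0, u₀]], and the matrix π̃₂(η,ξ) := (1/(u₀(u₀²−c₀²)(η²+ξ²)))·[[−u₀c₀²η², −u₀²v₀ηξ, u₀²v₀η²], [ηξc₀²(u₀²−c₀²)/v₀, ξ²u₀(u₀²−c₀²), −ηξu₀(u₀²−c₀²)], [−η²c₀²u₀²/v₀, −ηξu₀³, u₀³η²]]. Then A₂ is invertible, π̃₂(η,ξ)·E₂(η,ξ) = u₀·A₂⁻¹·E₂(η,ξ) = (u₀/((u₀²−c₀²)·√(η²+ξ²)))·(−ηv₀, ξ(u₀²−c₀²)/u₀, −ηu₀), and there exists a constant C > 0 depending only on v₀, u₀, c₀ such that |π̃₂(η,ξ)·E₂(η,ξ)| ≥ C for all (η,ξ) ≠ (0,0). -/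
/-- The unit eigenvector `E₂(η,ξ)` spanning `ker L(0,(τ₂(η,ξ),η,ξ))` for the linear
branch of the 2D isentropic Euler system at the subsonic state `V₀ = (v₀,0,u₀)`. -/
noncomputable def eulerE₂ (η ξ : ℝ) : Fin 3 → ℝ :=
  (Real.sqrt (η^2 + ξ^2))⁻¹ • ![0, ξ, -η]

/-- The normal coefficient matrix `A₂(V₀)` of the 2D isentropic Euler system. -/
noncomputable def eulerA₂ (v₀ u₀ c₀ : ℝ) : Matrix (Fin 3) (Fin 3) ℝ :=
  !![u₀, 0, -v₀; 0, u₀, 0; -c₀^2/v₀, 0, u₀]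

/-- The projector `π̃₂(η,ξ)` onto `A₂(V₀)⁻¹ ker L(0,(τ₂(η,ξ),η,ξ))`. -/
noncomputable def eulerPi₂ (v₀ u₀ c₀ η ξ : ℝ) : Matrix (Fin 3) (Fin 3) ℝ :=
  (1 / (u₀ * (u₀^2 - c₀^2) * (η^2 + ξ^2))) •
    !![-u₀*c₀^2*η^2,               -u₀^2*v₀*η*ξ,         u₀^2*v₀*η^2;
       η*ξ*c₀^2*(u₀^2-c₀^2)/v₀,    ξ^2*u₀*(u₀^2-c₀^2),   -η*ξ*u₀*(u₀^2-c₀^2);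
       -η^2*c₀^2*u₀^2/v₀,          -η*ξ*u₀^3,            u₀^3*η^2]

theorem det_eulerA₂ {v₀ : ℝ} (u₀ c₀ : ℝ) (hv₀ : v₀ ≠ 0) :
    (eulerA₂ v₀ u₀ c₀).det = u₀ * (u₀^2 - c₀^2) := by
  simp [eulerA₂, Matrix.det_fin_three]
  field_simp
  ring

theorem eulerPi₂_mulVec_eulerE₂ {v₀ u₀ c₀ η ξ : ℝ} (hu₀ : u₀ ≠ 0)
    (hd : u₀^2 - c₀^2 ≠ 0) (hr : 0 < η^2 + ξ^2) :
    (eulerPi₂ v₀ u₀ c₀ η ξ).mulVec (eulerE₂ η ξ) =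
      (u₀ / ((u₀^2 - c₀^2) * Real.sqrt (η^2 + ξ^2))) •
        ![-η*v₀, ξ*(u₀^2 - c₀^2)/u₀, -η*u₀] := by
  have hs : Real.sqrt (η^2 + ξ^2) ≠ 0 := (Real.sqrt_pos.mpr hr).ne'
  have hr' := hr.ne'
  ext i
  fin_cases i <;>
    simp [eulerPi₂, eulerE₂, Matrix.mulVec, dotProduct, Fin.sum_univ_three] <;>
    field_simp <;> ring

theorem eulerA₂_mulVec {v₀ u₀ c₀ : ℝ} (η ξ : ℝ) (hv₀ : v₀ ≠ 0) (hu₀ : u₀ ≠ 0)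
    (hd : u₀^2 - c₀^2 ≠ 0) :
    (eulerA₂ v₀ u₀ c₀).mulVec ((u₀ / ((u₀^2 - c₀^2) * Real.sqrt (η^2 + ξ^2))) •
        ![-η*v₀, ξ*(u₀^2 - c₀^2)/u₀, -η*u₀]) = u₀ • eulerE₂ η ξ := by
  rw [div_mul_eq_div_div, div_eq_mul_inv _ (Real.sqrt _)]
  ext i
  fin_cases i <;>
    simp [eulerA₂, eulerE₂, Matrix.mulVec, dotProduct, Fin.sum_univ_three, hu₀] <;>
    field_simp <;> ring

/-- For the 2D isentropic Euler system at the subsonic state `V₀ = (v₀,0,u₀)`: `A₂(V₀)`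
is invertible, `π̃₂(η,ξ)·E₂(η,ξ) = u₀·A₂(V₀)⁻¹·E₂(η,ξ)` is given by the explicit
formula, and its Euclidean norm is bounded below by a positive constant uniformly in
`(η,ξ) ≠ (0,0)`. -/
theorem stmt_18 (v₀ u₀ c₀ : ℝ) (hv₀ : 0 < v₀) (hu₀ : 0 < u₀) (huc : u₀ < c₀) :
    IsUnit (eulerA₂ v₀ u₀ c₀) ∧
    (∀ η ξ : ℝ, ¬(η = 0 ∧ ξ = 0) →
      (eulerPi₂ v₀ u₀ c₀ η ξ).mulVec (eulerE₂ η ξ) =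
        u₀ • (eulerA₂ v₀ u₀ c₀)⁻¹.mulVec (eulerE₂ η ξ) ∧
      (eulerPi₂ v₀ u₀ c₀ η ξ).mulVec (eulerE₂ η ξ) =
        (u₀ / ((u₀^2 - c₀^2) * Real.sqrt (η^2 + ξ^2))) •
          ![-η*v₀, ξ*(u₀^2 - c₀^2)/u₀, -η*u₀]) ∧
    (∃ C : ℝ, 0 < C ∧ ∀ η ξ : ℝ, ¬(η = 0 ∧ ξ = 0) →
      C ≤ Real.sqrt (((eulerPi₂ v₀ u₀ c₀ η ξ).mulVec (eulerE₂ η ξ) 0)^2 +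
            ((eulerPi₂ v₀ u₀ c₀ η ξ).mulVec (eulerE₂ η ξ) 1)^2 +
            ((eulerPi₂ v₀ u₀ c₀ η ξ).mulVec (eulerE₂ η ξ) 2)^2)) := by
  have hd : u₀^2 - c₀^2 ≠ 0 := by nlinarith
  have hr {η ξ : ℝ} (h : ¬(η = 0 ∧ ξ = 0)) : 0 < η^2 + ξ^2 := by
    contrapose! h
    constructor <;> nlinarith [sq_nonneg η, sq_nonneg ξ]
  have hdet : IsUnit (eulerA₂ v₀ u₀ c₀).det := by
    rw [det_eulerA₂ u₀ c₀ hv₀.ne']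
    exact (mul_ne_zero hu₀.ne' hd).isUnit
  refine ⟨(Matrix.isUnit_iff_isUnit_det _).mpr hdet, fun η ξ h => ⟨?_, ?_⟩,
    Real.sqrt (min (u₀^2 * (v₀^2 + u₀^2) / (u₀^2 - c₀^2)^2) 1), ?_, fun η ξ h => ?_⟩
  · rw [eulerPi₂_mulVec_eulerE₂ hu₀.ne' hd (hr h), ← Matrix.mulVec_smul,
      ← eulerA₂_mulVec η ξ hv₀.ne' hu₀.ne' hd, Matrix.mulVec_mulVec,
      Matrix.nonsing_inv_mul _ hdet, Matrix.one_mulVec]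
  · exact eulerPi₂_mulVec_eulerE₂ hu₀.ne' hd (hr h)
  · exact Real.sqrt_pos.mpr (lt_min (by positivity) one_pos)
  · apply Real.sqrt_le_sqrt
    have hr := hr h
    rw [eulerPi₂_mulVec_eulerE₂ hu₀.ne' hd hr]
    set K := u₀^2 * (v₀^2 + u₀^2) / (u₀^2 - c₀^2)^2 with hK
    trans (K * η^2 + ξ^2) / (η^2 + ξ^2)
    · rw [le_div_iff₀ hr]
      nlinarith [mul_le_mul_of_nonneg_right (min_le_left K 1) (sq_nonneg η),
        mul_le_mul_of_nonneg_right (min_le_right K 1) (sq_nonneg ξ)]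
    · apply le_of_eq
      simp only [Pi.smul_apply, smul_eq_mul, Matrix.cons_val, mul_pow, div_pow,
        Real.sq_sqrt hr.le, hK]
      field_simp
      ring
end

section
/- Let 0 < M < 1, δ > 1, c₀ > 0, η₀ > 0, and set K₋ := (√(1−M²) − δ)/(1 − √(1−M²)) and K₊ := (−√(1−M²) − δ)/(1 + √(1−M²)). Suppose there exists c > 0 such that for every q ∈ ℕ, q ≥ 1, and every p ∈ ℤ: |K₋ − p/q| ≥ c·q^{−5/2} and |K₊ − p/q| ≥ c·q^{−5/2}. Then there exists C > 0 such that for every (p,q) ∈ ℤ² \ {(0,0)}, with τ_{p,q} := c₀η₀(p + δq) and η_{p,q} := η₀(p + q): min(|τ_{p,q} − c₀√(1−M²)·η_{p,q}|, |τ_{p,q} + c₀√(1−M²)·η_{p,q}|) ≥ C·(p² + q²)^{−3/4}. -/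
/-- A Diophantine lower bound on `|K - p / q|` for `q ≥ 1` bounds the linear form `p - K q`
from below on all of `ℤ² \ {0}`. -/
lemma linear_form_lower_bound {K c : ℝ} (hc : 0 < c)
    (h : ∀ q : ℕ, 1 ≤ q → ∀ p : ℤ, c * (q : ℝ) ^ (-(5/2 : ℝ)) ≤ |K - (p : ℝ) / (q : ℝ)|)
    {p q : ℤ} (hpq : ¬(p = 0 ∧ q = 0)) :
    min c 1 * ((p : ℝ)^2 + (q : ℝ)^2) ^ (-(3/4 : ℝ)) ≤ |(p : ℝ) - K * q| := by
  rcases eq_or_ne q 0 with rfl | hq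
  · have hp : (1 : ℝ) ≤ |(p : ℝ)| := by
      exact_mod_cast Int.one_le_abs fun hp => hpq ⟨hp, rfl⟩
    have hp2 : (1 : ℝ) ≤ (p : ℝ)^2 + ((0 : ℤ) : ℝ)^2 := by
      rw [← sq_abs (p : ℝ)]
      push_cast
      nlinarith
    have hle := Real.rpow_le_one_of_one_le_of_nonpos hp2 (by norm_num : (-(3/4 : ℝ)) ≤ 0)
    calc min c 1 * ((p : ℝ)^2 + ((0 : ℤ) : ℝ)^2) ^ (-(3/4 : ℝ)) ≤ 1 * 1 := by
          gcongr
          exact min_le_right c 1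
      _ ≤ |(p : ℝ) - K * ((0 : ℤ) : ℝ)| := by simpa using hp
  · have hn : 1 ≤ q.natAbs := Int.natAbs_pos.mpr hq
    have hn0 : (0 : ℝ) < (q.natAbs : ℝ) := by exact_mod_cast hn
    have hsq : (q : ℝ)^2 = (q.natAbs : ℝ)^2 := by
      rw [Nat.cast_natAbs, Int.cast_abs, sq_abs]
    have hform : |(p : ℝ) - K * q| =
        q.natAbs * |K - ((q.sign * p : ℤ) : ℝ) / (q.natAbs : ℝ)| := by
      rw [← abs_of_pos hn0, ← abs_mul, abs_of_pos hn0, mul_sub, mul_div_cancel₀ _ hn0.ne']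
      rcases lt_or_gt_of_ne hq with hneg | hpos
      · rw [Int.sign_eq_neg_one_of_neg hneg, Nat.cast_natAbs, abs_of_neg hneg]
        push_cast
        congr 1
        ring
      · rw [Int.sign_eq_one_of_pos hpos, Nat.cast_natAbs, abs_of_pos hpos, abs_sub_comm]
        push_cast
        congr 1
        ring
    calc min c 1 * ((p : ℝ)^2 + (q : ℝ)^2) ^ (-(3/4 : ℝ))
        ≤ c * ((q.natAbs : ℝ)^2) ^ (-(3/4 : ℝ)) := by
          rw [hsq]
          refine mul_le_mul (min_le_left c 1) ?_ (by positivity) hc.le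
          exact Real.rpow_le_rpow_of_nonpos (by positivity)
            (le_add_of_nonneg_left (sq_nonneg _)) (by norm_num)
      _ = q.natAbs * (c * (q.natAbs : ℝ) ^ (-(5/2 : ℝ))) := by
          rw [← Real.rpow_natCast, ← Real.rpow_mul hn0.le, mul_left_comm,
            ← Real.rpow_one_add' hn0.le (by norm_num)]
          norm_num
      _ ≤ |(p : ℝ) - K * q| := by
          rw [hform]
          gcongr
          exact h _ hn _


/-- Small divisors for the Euler boundary frequency lattice: if the numbers `K₋` and
`K₊` satisfy the Roth-type Diophantine condition `|K± − p/q| ≥ c·q^{−5/2}`, then the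
distance of a nonzero lattice frequency `ζ_{p,q} = (τ_{p,q}, η_{p,q})` (with
`τ_{p,q} = c₀η₀(p+δq)`, `η_{p,q} = η₀(p+q)`) to the two glancing lines
`τ = ±c₀√(1−M²)η`, measured by the minimum of the two linear forms, is bounded below by
`C·(p²+q²)^{−3/4}` for some `C > 0`. -/
theorem stmt_19 (M δ c₀ η₀ : ℝ) (hM0 : 0 < M) (hM1 : M < 1) (hδ : 1 < δ)
    (hc₀ : 0 < c₀) (hη₀ : 0 < η₀)
    (Kminus Kplus : ℝ)
    (hKminus : Kminus = (Real.sqrt (1 - M^2) - δ) / (1 - Real.sqrt (1 - M^2)))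
    (hKplus : Kplus = (-Real.sqrt (1 - M^2) - δ) / (1 + Real.sqrt (1 - M^2)))
    (hdioph : ∃ c : ℝ, 0 < c ∧ ∀ q : ℕ, 1 ≤ q → ∀ p : ℤ,
      c * (q : ℝ) ^ (-(5/2 : ℝ)) ≤ |Kminus - (p : ℝ) / (q : ℝ)| ∧
      c * (q : ℝ) ^ (-(5/2 : ℝ)) ≤ |Kplus - (p : ℝ) / (q : ℝ)|) :
    ∃ C : ℝ, 0 < C ∧ ∀ p q : ℤ, ¬(p = 0 ∧ q = 0) →
      C * (((p : ℝ)^2 + (q : ℝ)^2) ^ (-(3/4 : ℝ))) ≤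
        min |c₀ * η₀ * ((p : ℝ) + δ * (q : ℝ)) -
              c₀ * Real.sqrt (1 - M^2) * (η₀ * ((p : ℝ) + (q : ℝ)))|
            |c₀ * η₀ * ((p : ℝ) + δ * (q : ℝ)) +
              c₀ * Real.sqrt (1 - M^2) * (η₀ * ((p : ℝ) + (q : ℝ)))| := by
  obtain ⟨c, hc, h⟩ := hdioph
  set s := Real.sqrt (1 - M^2) with hs
  have hs0 : 0 ≤ s := Real.sqrt_nonneg _
  have hs1 : s < 1 := by
    rw [hs, Real.sqrt_lt' one_pos]
    nlinarith
  have hs2 : 0 < 1 - s := sub_pos.mpr hs1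
  refine ⟨c₀ * η₀ * (1 - s) * min c 1, by positivity, fun p q hpq => ?_⟩
  have hminus := linear_form_lower_bound hc (fun q hq p => (h q hq p).1) hpq
  have hplus := linear_form_lower_bound hc (fun q hq p => (h q hq p).2) hpq
  have eminus : c₀ * η₀ * ((p : ℝ) + δ * q) - c₀ * s * (η₀ * ((p : ℝ) + q)) =
      c₀ * η₀ * (1 - s) * ((p : ℝ) - Kminus * q) := by
    rw [hKminus]
    field_simp
    ring
  have eplus : c₀ * η₀ * ((p : ℝ) + δ * q) + c₀ * s * (η₀ * ((p : ℝ) + q)) =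
      c₀ * η₀ * (1 + s) * ((p : ℝ) - Kplus * q) := by
    rw [hKplus]
    field_simp
    ring
  rw [eminus, eplus, abs_mul (c₀ * η₀ * (1 - s)), abs_mul (c₀ * η₀ * (1 + s)),
    abs_of_pos (by positivity : 0 < c₀ * η₀ * (1 - s)),
    abs_of_pos (by positivity : 0 < c₀ * η₀ * (1 + s)), mul_assoc _ (min c 1)]
  refine le_min (by gcongr) ?_
  gcongr
  linarith
end
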